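/- There is a constant C depending only on k such that for every cell τ_j and every function w of class C^{k+1} on the closure of τ_j, the (k+1)st Radau coefficient satisfies |w_{j,k+1}| ≤ C h_j^{k+1} sup_{x ∈ τ_j} |w^{(k+1)}(x)|. -/

import Mathlib

open MeasureTheory intervalIntegral

/-- Legendre polynomial of degree `m` via the Rodrigues formula. -/
noncomputable def legendreP (m : ℕ) : ℝ → ℝ :=
  fun s => (1 / ((2:ℝ) ^ m * (Nat.factorial m : ℝ))) *
    iteratedDeriv m (fun t : ℝ => (t ^ 2 - 1) ^ m) s

/-- Legendre polynomial rescaled to the cell `(a, b)`. -/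
noncomputable def legendreCell (m : ℕ) (a b : ℝ) : ℝ → ℝ :=
  fun x => legendreP m ((2 * x - (a + b)) / (b - a))

/-- `P` is the Gauss–Radau projection (onto polynomials of degree ≤ k on `(a,b)`) of `u`. -/
def IsGRProj (k : ℕ) (a b : ℝ) (u : ℝ → ℝ) (P : Polynomial ℝ) : Prop :=
  P.natDegree ≤ k ∧
  (∀ v : Polynomial ℝ, v.natDegree + 1 ≤ k →
    (∫ x in a..b, P.eval x * v.eval x) = ∫ x in a..b, u x * v.eval x) ∧
  P.eval b = u b

/-- The scaled primitive `(D⁻¹ v)(x) = (2/(b-a)) ∫_a^x v`. -/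
noncomputable def Dinv (a b : ℝ) (v : ℝ → ℝ) : ℝ → ℝ :=
  fun x => (2 / (b - a)) * ∫ t in a..x, v t

/-- `F` is the sequence of correction polynomials on the cell `(a,b)`:
`F 1 = P_h^-(D⁻¹ L_k)` and `F i = -P_h^-(D⁻¹ F (i-1))` for `i ≥ 2`. -/
def IsFSeq (k : ℕ) (a b : ℝ) (F : ℕ → Polynomial ℝ) : Prop :=
  IsGRProj k a b (Dinv a b (legendreCell k a b)) (F 1) ∧
  ∀ i, 2 ≤ i → IsGRProj k a b (Dinv a b (fun x => (F (i-1)).eval x)) (-(F i))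

/-- The `m`-th Radau coefficient of `w` on the cell `(a,b)`. -/
noncomputable def radauCoeff (a b : ℝ) (w : ℝ → ℝ) (m : ℕ) : ℝ :=
  w b - (1 / (b - a)) *
    ∫ x in a..b, w x * ∑ l ∈ Finset.range m, (2 * (l:ℝ) + 1) * legendreCell l a b x

/-- `G_i(t) = (d/dt)^i u_{j,k+1}(t)` for `u(x,t) = u0(x - t)` on the cell `(a,b)`. -/
noncomputable def Gfun (k : ℕ) (a b : ℝ) (u0 : ℝ → ℝ) (i : ℕ) (t : ℝ) : ℝ :=
  iteratedDeriv i (fun s => radauCoeff a b (fun y => u0 (y - s)) (k + 1)) t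

/-- `w_i(x,t) = (h_j/2)^i G_i(t) F_i(x)` on the cell `(a,b)`. -/
noncomputable def wFun (k : ℕ) (a b : ℝ) (u0 : ℝ → ℝ) (F : ℕ → Polynomial ℝ)
    (i : ℕ) (y t : ℝ) : ℝ :=
  ((b - a) / 2) ^ i * Gfun k a b u0 i t * (F i).eval y

/-- `w^l = Σ_{i=1}^l w_i` on the cell `(a,b)`. -/
noncomputable def wSum (k : ℕ) (a b : ℝ) (u0 : ℝ → ℝ) (F : ℕ → Polynomial ℝ)
    (l : ℕ) (y t : ℝ) : ℝ :=
  ∑ i ∈ Finset.Icc 1 l, wFun k a b u0 F i y t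

/-- The interpolation function `u_I^l = P_h^- u - w^l` on the cell `(a,b)`;
here `P t` is the Gauss–Radau projection of `u(·,t)`. -/
noncomputable def uIl (k : ℕ) (a b : ℝ) (u0 : ℝ → ℝ) (P : ℝ → Polynomial ℝ)
    (F : ℕ → Polynomial ℝ) (l : ℕ) (y t : ℝ) : ℝ :=
  (P t).eval y - wSum k a b u0 F l y t

/-- `uh` is a DG solution on `[0,T]` on the mesh `x 0 < x 1 < … < x N`
(the piece on the cell `τ_j = (x (j-1), x j)` is the polynomial `uh j t`),
with prescribed inflow value `inflow t` at the left boundary. -/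
def IsDGSol (k N : ℕ) (x : ℕ → ℝ) (T : ℝ) (inflow : ℝ → ℝ)
    (uh : ℕ → ℝ → Polynomial ℝ) : Prop :=
  (∀ j ∈ Finset.Icc 1 N, ∀ t : ℝ, (uh j t).natDegree ≤ k) ∧
  (∀ j ∈ Finset.Icc 1 N, ∀ y : ℝ, ContDiff ℝ 1 (fun t => (uh j t).eval y)) ∧
  (∀ j ∈ Finset.Icc 1 N, ∀ t ∈ Set.Icc (0:ℝ) T, ∀ v : Polynomial ℝ, v.natDegree ≤ k →
    (∫ y in (x (j-1))..(x j), deriv (fun s => (uh j s).eval y) t * v.eval y)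
      - (∫ y in (x (j-1))..(x j), (uh j t).eval y * v.derivative.eval y)
      + (uh j t).eval (x j) * v.eval (x j)
      - (if j = 1 then inflow t else (uh (j-1) t).eval (x (j-1))) * v.eval (x (j-1)) = 0)

/-- The error `u - u_I^l` on the cell `τ_j`, as a function of `(y, s)`. -/
noncomputable def errFun (k l : ℕ) (x : ℕ → ℝ) (u0 : ℝ → ℝ)
    (P : ℕ → ℝ → Polynomial ℝ) (F : ℕ → ℕ → Polynomial ℝ) (j : ℕ) (y s : ℝ) : ℝ :=
  u0 (y - s) - uIl k (x (j-1)) (x j) u0 (P j) (F j) l y s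

open Polynomial in
/-- Integral over `[-1,1]` as a linear functional on polynomials. -/
noncomputable def polyInt : ℝ[X] →ₗ[ℝ] ℝ where
  toFun p := ∫ x in (-1:ℝ)..1, p.eval x
  map_add' p q := by
    simp only [eval_add]
    exact intervalIntegral.integral_add (p.continuous.intervalIntegrable _ _)
      (q.continuous.intervalIntegrable _ _)
  map_smul' c p := by
    simp only [eval_smul, smul_eq_mul, RingHom.id_apply]
    exact intervalIntegral.integral_const_mul _ _

open Polynomial

theorem polyInt_apply (p : ℝ[X]) : polyInt p = ∫ x in (-1:ℝ)..1, p.eval x := rfl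

theorem polyInt_derivative (p : ℝ[X]) : polyInt (derivative p) = p.eval 1 - p.eval (-1) := by
  rw [polyInt_apply]
  exact intervalIntegral.integral_eq_sub_of_hasDerivAt (fun x _ => p.hasDerivAt x)
    (p.derivative.continuous.intervalIntegrable _ _)

theorem q_factor_one (n : ℕ) :
    ((X ^ 2 - 1 : ℝ[X]) ^ n).map (algebraMap ℝ ℝ) = (X - C 1) ^ n * (X + 1) ^ n := by
  rw [← mul_pow]
  simp only [Algebra.algebraMap_self, Polynomial.map_id, map_one]
  ring

theorem q_factor_neg (n : ℕ) :
    ((X ^ 2 - 1 : ℝ[X]) ^ n).map (algebraMap ℝ ℝ) = (X - C (-1)) ^ n * (X - 1) ^ n := by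
  rw [← mul_pow]
  simp only [Algebra.algebraMap_self, Polynomial.map_id, map_neg, map_one]
  ring

/-- Legendre polynomial as a polynomial. -/
noncomputable def legPoly (n : ℕ) : ℝ[X] :=
  (1 / ((2:ℝ) ^ n * (Nat.factorial n : ℝ))) • derivative^[n] ((X ^ 2 - 1) ^ n)

theorem iteratedDeriv_poly (n : ℕ) (p : ℝ[X]) :
    iteratedDeriv n (fun x => p.eval x) = fun x => (derivative^[n] p).eval x := by
  induction n with
  | zero => simp
  | succ n ih =>
    rw [iteratedDeriv_succ, ih, Function.iterate_succ_apply']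
    funext x
    exact Polynomial.deriv _

theorem legendreP_eq (n : ℕ) (s : ℝ) : legendreP n s = (legPoly n).eval s := by
  have h := iteratedDeriv_poly n ((X ^ 2 - 1) ^ n)
  simp only [eval_pow, eval_sub, eval_X, eval_one] at h
  simp only [legendreP, legPoly, h, eval_smul, smul_eq_mul]

theorem legPoly_one (n : ℕ) : (legPoly n).eval 1 = 1 := by
  have h := aeval_iterate_derivative_self _ n _ (q_factor_one n)
  rw [coe_aeval_eq_eval] at h
  simp only [legPoly, eval_smul, h]
  have : (n.factorial : ℝ) ≠ 0 := by positivity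
  simp only [eval_pow, eval_add, eval_X, eval_one, nsmul_eq_mul, smul_eq_mul]
  norm_num
  field_simp

theorem legPoly_neg_sq (n : ℕ) : (legPoly n).eval (-1) ^ 2 = 1 := by
  have h := aeval_iterate_derivative_self _ n _ (q_factor_neg n)
  rw [coe_aeval_eq_eval] at h
  simp only [legPoly, eval_smul, h]
  have : (n.factorial : ℝ) ≠ 0 := by positivity
  simp only [eval_pow, eval_sub, eval_X, eval_one, nsmul_eq_mul, smul_eq_mul]
  have h2 : ((-1 - 1 : ℝ)) ^ n = (-1) ^ n * 2 ^ n := by rw [← mul_pow]; norm_num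
  rw [h2]
  field_simp
  rw [← pow_mul, mul_comm, pow_mul]; simp

theorem orth_aux (n m : ℕ) (hm : m ≤ n) (p : ℝ[X]) (hp : derivative^[m] p = 0) :
    polyInt (derivative^[m] ((X ^ 2 - 1) ^ n) * p) = 0 := by
  induction m generalizing p with
  | zero =>
    have : p = 0 := hp
    simp [this]
  | succ m ih =>
    have h1 := ih (by omega) (derivative p) hp
    have h2 := polyInt_derivative (derivative^[m] ((X ^ 2 - 1) ^ n) * p)
    have e1 := aeval_iterate_derivative_of_lt _ n _ (q_factor_one n) (show m < n by omega)
    have e2 := aeval_iterate_derivative_of_lt _ n _ (q_factor_neg n) (show m < n by omega)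
    rw [coe_aeval_eq_eval] at e1 e2
    rw [derivative_mul, map_add, h1, eval_mul, eval_mul, e1, e2,
      ← Function.iterate_succ_apply' (f := derivative)] at h2
    simpa using h2

theorem leg_orth (n : ℕ) (p : ℝ[X]) (hp : p.degree < n) : polyInt (legPoly n * p) = 0 := by
  rw [legPoly, smul_mul_assoc, map_smul,
    orth_aux n n le_rfl p (iterate_derivative_eq_zero_of_degree_lt hp), smul_zero]

theorem legPoly_degree (n : ℕ) : (legPoly n).degree ≤ n := by
  rw [degree_le_iff_coeff_zero]
  intro m hm
  have hm' : n < m := by exact_mod_cast hm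
  rw [legPoly, coeff_smul, coeff_iterate_derivative, coeff_eq_zero_of_natDegree_lt]
  · simp
  · refine lt_of_le_of_lt (natDegree_pow_le_of_le n (m := 2) ?_) (by omega)
    compute_degree

theorem leg_norm (n : ℕ) : (2 * (n:ℝ) + 1) * polyInt (legPoly n * legPoly n) = 2 := by
  have h2 := polyInt_derivative (X * (legPoly n * legPoly n))
  have hq : polyInt (legPoly n * (X * derivative (legPoly n) - (n:ℝ) • legPoly n)) = 0 := by
    apply leg_orth
    rw [degree_lt_iff_coeff_zero]
    intro m hm
    rw [coeff_sub, coeff_smul, smul_eq_mul]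
    have hc : (X * derivative (legPoly n)).coeff m = m * (legPoly n).coeff m := by
      cases m with
      | zero => simp
      | succ m => rw [coeff_X_mul, coeff_derivative]; push_cast; ring
    rw [hc]
    rcases hm.eq_or_lt with rfl | h
    · ring
    · rw [(degree_le_iff_coeff_zero _ _).1 (legPoly_degree n) m (by exact_mod_cast h)]; ring
  have e : derivative (X * (legPoly n * legPoly n)) =
      (2 * (n:ℝ) + 1) • (legPoly n * legPoly n) +
      (2:ℝ) • (legPoly n * (X * derivative (legPoly n) - (n:ℝ) • legPoly n)) := by
    simp only [derivative_mul, derivative_X, smul_eq_C_mul, map_add, map_mul, map_one, C_ofNat]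
    ring
  rw [e, map_add, map_smul, map_smul, hq] at h2
  have h3 := legPoly_neg_sq n
  simp only [eval_mul, eval_X, legPoly_one, smul_eq_mul] at h2
  nlinarith

/-- The kernel `∑_{l<m} (2l+1) L_l`. -/
noncomputable def kerPoly (m : ℕ) : ℝ[X] :=
  ∑ l ∈ Finset.range m, (2 * (l:ℝ) + 1) • legPoly l

theorem kerPoly_degree (m : ℕ) : (kerPoly m).degree < m := by
  rw [kerPoly, degree_lt_iff_coeff_zero]
  intro j hj
  rw [finsetSum_coeff]
  apply Finset.sum_eq_zero
  intro l hl
  rw [Finset.mem_range] at hl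
  rw [coeff_smul, (degree_le_iff_coeff_zero _ _).1 (legPoly_degree l) j (by
    exact_mod_cast (by omega : l < j)), smul_zero]

theorem ker_repr (m : ℕ) (p : ℝ[X]) (hp : p.degree < m) :
    polyInt (p * kerPoly m) = 2 * p.eval 1 := by
  induction m generalizing p with
  | zero =>
    have : p = 0 := by simpa using hp
    simp [this]
  | succ m ih =>
    have hlead : (legPoly m).coeff m ≠ 0 := by
      intro h0
      have : (legPoly m).degree < m := by
        rw [degree_lt_iff_coeff_zero]
        intro j hj
        rcases hj.eq_or_lt with rfl | h
        · exact h0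
        · exact (degree_le_iff_coeff_zero _ _).1 (legPoly_degree m) j (by exact_mod_cast h)
      have h1 := leg_orth m _ this
      have h2 := leg_norm m
      rw [h1] at h2
      norm_num at h2
    set c := p.coeff m / (legPoly m).coeff m with hc
    set q := p - c • legPoly m with hq
    have hqd : q.degree < m := by
      rw [degree_lt_iff_coeff_zero]
      intro j hj
      rw [hq, coeff_sub, coeff_smul, smul_eq_mul]
      rcases hj.eq_or_lt with rfl | h
      · rw [hc]; field_simp; simp
      · rw [(degree_le_iff_coeff_zero _ _).1 (legPoly_degree m) j (by exact_mod_cast h),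
          degree_lt_iff_coeff_zero _ _ |>.1 hp j h]; ring
    have hp' : p = q + c • legPoly m := by rw [hq]; ring
    have hk : kerPoly (m+1) = kerPoly m + (2 * (m:ℝ) + 1) • legPoly m := by
      rw [kerPoly, Finset.sum_range_succ, kerPoly]
    have e : p * kerPoly (m+1) = q * kerPoly m + (2 * (m:ℝ) + 1) • (legPoly m * q)
        + c • (legPoly m * kerPoly m)
        + c • ((2 * (m:ℝ) + 1) • (legPoly m * legPoly m)) := by
      rw [hk, hp']
      simp only [smul_eq_C_mul]
      ring
    rw [e, map_add, map_add, map_add, ih q hqd, map_smul, map_smul, map_smul, map_smul,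
      leg_orth m q hqd, leg_orth m _ (kerPoly_degree m)]
    simp only [smul_eq_mul]
    rw [leg_norm, hp']
    simp only [eval_add, eval_smul, legPoly_one, smul_eq_mul]
    ring

theorem ker_cell (m : ℕ) (a b x : ℝ) :
    ∑ l ∈ Finset.range m, (2 * (l:ℝ) + 1) * legendreCell l a b x =
      (kerPoly m).eval ((2 * x - (a + b)) / (b - a)) := by
  simp only [kerPoly, eval_finsetSum, eval_smul, smul_eq_mul, legendreCell, legendreP_eq]

theorem radau_poly (k : ℕ) (a b : ℝ) (hab : a < b) (T : ℝ[X]) (hT : T.natDegree ≤ k) :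
    ∫ x in a..b, T.eval x * (kerPoly (k+1)).eval ((2 * x - (a + b)) / (b - a)) =
      (b - a) * T.eval b := by
  have hba : 0 < b - a := sub_pos.2 hab
  set g : ℝ[X] := C ((b-a)/2) * X + C ((a+b)/2) with hg
  have hgd : g.natDegree ≤ 1 := by rw [hg]; compute_degree
  have hd : (T.comp g).degree < ((k+1 : ℕ) : WithBot ℕ) := by
    refine lt_of_le_of_lt degree_le_natDegree ?_
    have : (T.comp g).natDegree ≤ T.natDegree * g.natDegree := natDegree_comp_le
    have h3 : T.natDegree * g.natDegree ≤ k * 1 := Nat.mul_le_mul hT hgd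
    exact_mod_cast (by omega : (T.comp g).natDegree < k + 1)
  have h := ker_repr (k+1) (T.comp g) hd
  have hc : (b-a)/2 ≠ 0 := by positivity
  have h2 := intervalIntegral.integral_comp_mul_add (a := -1) (b := 1)
    (fun x => T.eval x * (kerPoly (k+1)).eval ((2 * x - (a + b)) / (b - a))) hc ((a+b)/2)
  have e1 : (b-a)/2 * (-1) + (a+b)/2 = a := by ring
  have e2 : (b-a)/2 * 1 + (a+b)/2 = b := by ring
  rw [e1, e2] at h2
  have h4 : (fun x : ℝ => (T.comp g * kerPoly (k+1)).eval x) = fun x : ℝ =>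
      T.eval ((b-a)/2 * x + (a+b)/2) * (kerPoly (k+1)).eval
        ((2 * ((b-a)/2 * x + (a+b)/2) - (a + b)) / (b - a)) := by
    funext x
    have : (2 * ((b-a)/2 * x + (a+b)/2) - (a + b)) / (b - a) = x := by
      field_simp; ring
    rw [this, eval_mul, eval_comp, hg]
    simp
  rw [polyInt_apply, h4, h2, eval_comp, hg] at h
  simp only [eval_add, eval_mul, eval_C, eval_X, e2, smul_eq_mul] at h
  field_simp at h
  linarith

/-- `|w_{j,k+1}| ≤ C h_j^{k+1} sup |w^{(k+1)}|` with `C` depending only on `k`. -/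
theorem stmt9 (k : ℕ) (hk : 1 ≤ k) :
    ∃ C : ℝ, 0 < C ∧
      ∀ (a b : ℝ), a < b → ∀ w : ℝ → ℝ,
        ContDiffOn ℝ (k+1) w (Set.Icc a b) →
        ∀ M : ℝ,
          (∀ y ∈ Set.Icc a b, |iteratedDerivWithin (k+1) w (Set.Icc a b) y| ≤ M) →
          |radauCoeff a b w (k+1)| ≤ C * (b-a)^(k+1) * M := by
  obtain ⟨B, hB⟩ := (isCompact_Icc (a := (-1:ℝ)) (b := 1)).exists_bound_of_continuousOn
    (f := fun x => (kerPoly (k+1)).eval x) (kerPoly (k+1)).continuous.continuousOn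
  have hB0 : 0 ≤ B := (norm_nonneg _).trans (hB 0 (by norm_num))
  refine ⟨1 + B, by positivity, ?_⟩
  intro a b hab w hw M hM
  have hba : 0 < b - a := sub_pos.2 hab
  have hM0 : 0 ≤ M := (abs_nonneg _).trans (hM a (Set.left_mem_Icc.2 hab.le))
  obtain ⟨T, hTd, hT⟩ : ∃ T : ℝ[X], T.natDegree ≤ k ∧
      ∀ x, T.eval x = taylorWithinEval w k (Set.Icc a b) a x := by
    refine ⟨∑ i ∈ Finset.range (k+1),
      C ((i.factorial : ℝ)⁻¹ * iteratedDerivWithin i w (Set.Icc a b) a) * (X - C a) ^ i, ?_, ?_⟩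
    · apply natDegree_sum_le_of_forall_le
      intro i hi
      rw [Finset.mem_range] at hi
      refine (natDegree_C_mul_le _ _).trans ?_
      rw [natDegree_pow, natDegree_X_sub_C]
      omega
    · intro x
      rw [taylor_within_apply, eval_finsetSum]
      refine Finset.sum_congr rfl fun i _ => ?_
      simp only [eval_mul, eval_C, eval_pow, eval_sub, eval_X, smul_eq_mul]
      ring
  have hR : ∀ x ∈ Set.Icc a b, |w x - T.eval x| ≤ (b-a)^(k+1) * M := by
    intro x hx
    have h := taylor_mean_remainder_bound hab.le hw hx hM
    rw [← hT, Real.norm_eq_abs] at h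
    refine h.trans ?_
    have h1 : (x - a)^(k+1) ≤ (b-a)^(k+1) :=
      pow_le_pow_left₀ (sub_nonneg.2 hx.1) (by linarith [hx.2]) _
    have h0 : 0 ≤ (x - a)^(k+1) := pow_nonneg (sub_nonneg.2 hx.1) _
    have hf : (1:ℝ) ≤ k.factorial := by exact_mod_cast k.factorial_pos
    refine (div_le_self (by positivity) hf).trans ?_
    rw [mul_comm]
    gcongr
  have hKc : Continuous fun x : ℝ => (kerPoly (k+1)).eval ((2 * x - (a + b)) / (b - a)) :=
    (kerPoly (k+1)).continuous.comp (by fun_prop)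
  have hint : ∫ x in a..b, (w x - T.eval x) *
      (kerPoly (k+1)).eval ((2 * x - (a + b)) / (b - a)) =
      (∫ x in a..b, w x * (kerPoly (k+1)).eval ((2 * x - (a + b)) / (b - a))) -
      (b - a) * T.eval b := by
    rw [← radau_poly k a b hab T hTd, ← intervalIntegral.integral_sub]
    · simp only [sub_mul]
    · apply ContinuousOn.intervalIntegrable
      rw [Set.uIcc_of_le hab.le]
      exact hw.continuousOn.mul hKc.continuousOn
    · exact (T.continuous.mul hKc).intervalIntegrable _ _
  have hbd : |∫ x in a..b, (w x - T.eval x) *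
      (kerPoly (k+1)).eval ((2 * x - (a + b)) / (b - a))| ≤
      ((b-a)^(k+1) * M * B) * |b - a| := by
    rw [← Real.norm_eq_abs]
    apply intervalIntegral.norm_integral_le_of_norm_le_const
    intro x hx
    rw [Set.uIoc_of_le hab.le] at hx
    have hx' : x ∈ Set.Icc a b := ⟨hx.1.le, hx.2⟩
    rw [norm_mul]
    refine mul_le_mul (hR x hx') (hB _ ?_) (norm_nonneg _) (by positivity)
    constructor
    · rw [le_div_iff₀ hba]; linarith [hx'.1]
    · rw [div_le_iff₀ hba]; linarith [hx'.2]
  rw [abs_of_pos hba] at hbd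
  have key : radauCoeff a b w (k+1) = (w b - T.eval b) - (1/(b-a)) *
      ∫ x in a..b, (w x - T.eval x) *
        (kerPoly (k+1)).eval ((2 * x - (a + b)) / (b - a)) := by
    rw [hint]
    simp only [radauCoeff, ker_cell]
    field_simp
    ring
  rw [key]
  refine (abs_sub _ _).trans ?_
  rw [abs_mul, abs_of_pos (by positivity : 0 < 1/(b-a))]
  have h5 := mul_le_mul_of_nonneg_left hbd (by positivity : 0 ≤ 1/(b-a))
  have h6 : 1/(b-a) * (((b-a)^(k+1) * M * B) * (b - a)) = (b-a)^(k+1) * M * B := by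
    field_simp
  have h7 := hR b (Set.right_mem_Icc.2 hab.le)
  rw [h6] at h5
  nlinarith
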